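/- arXiv:2511.16647 — 4 statements merged into one kernel-verified Lean document; each statement's English description precedes it below -/
import Mathlib

section
/- Let (a_n)_{n≥1} be a sequence of distinct positive real numbers such that inf_{m≠n} |a_m − a_n| ≥ c for some positive constant c, and let ε > 0. Then for almost all α ∈ [0,1] (with respect to Lebesgue measure) there exists N₀(α) such that for all N ≥ N₀(α), δ_min^α(N) ≥ 1 / (D_N · log N · (log₂ N)^{1+ε}). -/
open MeasureTheory Filter

/-- Distance from a real number to the nearest integer. -/
noncomputable def nint (x : ℝ) : ℝ := |x - round x|

/-- `deltaMin a α N` is the minimal gap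
`min { ‖α (a_m − a_n)‖ : 1 ≤ m ≠ n ≤ N }`. -/
noncomputable def deltaMin (a : ℕ → ℝ) (α : ℝ) (N : ℕ) : ℝ :=
  sInf {d : ℝ | ∃ m n : ℕ, 1 ≤ m ∧ m ≤ N ∧ 1 ≤ n ∧ n ≤ N ∧ m ≠ n ∧
    d = nint (α * (a m - a n))}

/-- `Dcard a N` is the number of distinct positive differences
`#{ |a_m − a_n| : 1 ≤ m ≠ n ≤ N }`. -/
noncomputable def Dcard (a : ℕ → ℝ) (N : ℕ) : ℕ :=
  Set.ncard {x : ℝ | ∃ m n : ℕ, 1 ≤ m ∧ m ≤ N ∧ 1 ≤ n ∧ n ≤ N ∧ m ≠ n ∧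
    x = |a m - a n|}

/-- `Log x = max (1, log x)`. -/
noncomputable def Log (x : ℝ) : ℝ := max 1 (Real.log x)

/-- Iterated logarithm `log₂ x = Log (Log x)`. -/
noncomputable def Log2 (x : ℝ) : ℝ := Log (Log x)

/-- The set of distances `|a m - a n|` between distinct terms among `a 1, …, a N`. -/
def diffSet (a : ℕ → ℝ) (N : ℕ) : Set ℝ :=
  {x : ℝ | ∃ m n : ℕ, 1 ≤ m ∧ m ≤ N ∧ 1 ≤ n ∧ n ≤ N ∧ m ≠ n ∧ x = |a m - a n|}

lemma diffSet_mono (a : ℕ → ℝ) : Monotone (diffSet a) := by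
  rintro M N h x ⟨m, n, h1, h2, h3, h4, h5⟩
  exact ⟨m, n, h1, h2.trans h, h3, h4.trans h, h5⟩

lemma diffSet_subset_image (a : ℕ → ℝ) (N : ℕ) :
    diffSet a N ⊆ ((Finset.Icc 1 N ×ˢ Finset.Icc 1 N).image fun p => |a p.1 - a p.2| :
      Finset ℝ) := by
  rintro x ⟨m, n, h1, h2, h3, h4, -, rfl⟩
  simp only [Finset.coe_image, Set.mem_image, Finset.mem_coe, Finset.mem_product, Finset.mem_Icc]
  exact ⟨(m, n), ⟨⟨h1, h2⟩, h3, h4⟩, rfl⟩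

lemma diffSet_finite (a : ℕ → ℝ) (N : ℕ) : (diffSet a N).Finite :=
  (Finset.finite_toSet _).subset (diffSet_subset_image a N)

lemma Dcard_le_sq (a : ℕ → ℝ) (N : ℕ) : Dcard a N ≤ N ^ 2 := by
  refine (Set.ncard_le_ncard (diffSet_subset_image a N) (Finset.finite_toSet _)).trans ?_
  rw [Set.ncard_coe_finset]
  refine Finset.card_image_le.trans ?_
  simp [sq]

lemma Dcard_mono (a : ℕ → ℝ) : Monotone (Dcard a) := fun _ N h =>
  Set.ncard_le_ncard (diffSet_mono a h) (diffSet_finite a N)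

lemma Dcard_pos (a : ℕ → ℝ) {N : ℕ} (hN : 2 ≤ N) : 0 < Dcard a N :=
  (Set.ncard_pos (diffSet_finite a N)).2
    ⟨|a 1 - a 2|, 1, 2, le_rfl, by omega, by omega, hN, by omega, rfl⟩

lemma one_le_Log (x : ℝ) : 1 ≤ Log x := le_max_left _ _

lemma Log_mono {x y : ℝ} (hx : 0 < x) (h : x ≤ y) : Log x ≤ Log y :=
  max_le_max le_rfl (Real.log_le_log hx h)

lemma one_le_Log2 (x : ℝ) : 1 ≤ Log2 x := one_le_Log _

lemma Log2_mono {x y : ℝ} (hx : 0 < x) (h : x ≤ y) : Log2 x ≤ Log2 y :=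
  Log_mono (one_pos.trans_le (one_le_Log x)) (Log_mono hx h)

lemma Log_le_two_mul_of_le_sq {x y : ℝ} (hx : 0 < x) (h : x ≤ y ^ 2) :
    Log x ≤ 2 * Log y := by
  have h1 := Real.log_le_log hx h
  rw [Real.log_pow] at h1
  have h2 : Real.log y ≤ Log y := le_max_right _ _
  have h3 := one_le_Log y
  refine max_le (by linarith) ?_
  push_cast at h1
  linarith

lemma Log_le_two_mul_of_le_two_mul {x y : ℝ} (hx : 0 < x) (hy : 0 < y) (h : x ≤ 2 * y) :
    Log x ≤ 2 * Log y := by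
  have h1 := Real.log_le_log hx h
  rw [Real.log_mul two_ne_zero hy.ne'] at h1
  have h2 : Real.log y ≤ Log y := le_max_right _ _
  have h3 := one_le_Log y
  have h4 := Real.log_two_lt_d9
  exact max_le (by linarith) (by linarith)

lemma Log2_le_two_mul_of_le_sq {x y : ℝ} (hx : 0 < x) (h : x ≤ y ^ 2) :
    Log2 x ≤ 2 * Log2 y :=
  Log_le_two_mul_of_le_two_mul (one_pos.trans_le (one_le_Log x)) (one_pos.trans_le (one_le_Log y))
    (Log_le_two_mul_of_le_sq hx h)

lemma quarter_le_Log (k : ℕ) : (k : ℝ) / 4 ≤ Log (Log ((2 : ℝ) ^ (2 ^ k))) := by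
  have h0 := Real.log_two_gt_d9
  rcases Nat.lt_or_ge k 2 with hk | hk
  · have : (k : ℝ) ≤ 2 := by exact_mod_cast hk.le
    linarith [one_le_Log (Log ((2 : ℝ) ^ (2 ^ k)))]
  obtain ⟨j, rfl⟩ : ∃ j, k = j + 1 := ⟨k - 1, by omega⟩
  have hj : (1 : ℝ) ≤ j := by exact_mod_cast (by omega : 1 ≤ j)
  have h1 : (2 : ℝ) ^ j ≤ Log ((2 : ℝ) ^ (2 ^ (j + 1))) := by
    refine le_trans ?_ (le_max_right _ _)
    rw [Real.log_pow]
    push_cast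
    have : (0 : ℝ) < 2 ^ j := by positivity
    rw [pow_succ]
    nlinarith
  have h2 : Real.log ((2 : ℝ) ^ j) ≤ Log (Log ((2 : ℝ) ^ (2 ^ (j + 1)))) :=
    (Real.log_le_log (by positivity) h1).trans (le_max_right _ _)
  rw [Real.log_pow] at h2
  push_cast
  nlinarith

/-- Bertrand series at the double logarithmic scale. -/
lemma summable_one_div_mul_Log_mul_Log2_rpow {ε : ℝ} (hε : 0 < ε) :
    Summable fun k : ℕ => 1 / ((k : ℝ) * Log k * Log2 k ^ (1 + ε)) := by
  have hL : ∀ x, 0 < Log x := fun x => one_pos.trans_le (one_le_Log x)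
  have hL2 : ∀ x, 0 < Log2 x := fun x => one_pos.trans_le (one_le_Log2 x)
  rw [← summable_condensed_iff_of_nonneg]
  rotate_left
  · intro n
    have := hL n
    have := hL2 n
    positivity
  · intro m n hm hmn
    have hm' : (0 : ℝ) < m := by exact_mod_cast hm
    have hmn' : (m : ℝ) ≤ n := by exact_mod_cast hmn
    have := hL m
    have := hL2 m
    have := hL n
    have := Log_mono hm' hmn'
    have := Log2_mono hm' hmn'
    gcongr
  have key : (fun k : ℕ => (2 : ℝ) ^ k *
      (1 / (((2 ^ k : ℕ) : ℝ) * Log ((2 ^ k : ℕ) : ℝ) * Log2 ((2 ^ k : ℕ) : ℝ) ^ (1 + ε)))) =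
      fun k : ℕ => 1 / (Log ((2 : ℝ) ^ k) * Log2 ((2 : ℝ) ^ k) ^ (1 + ε)) := by
    ext k
    have := hL ((2 : ℝ) ^ k)
    have := hL2 ((2 : ℝ) ^ k)
    push_cast
    field_simp
  rw [key, ← summable_condensed_iff_of_nonneg]
  rotate_left
  · intro n
    have := hL ((2 : ℝ) ^ n)
    have := hL2 ((2 : ℝ) ^ n)
    positivity
  · intro m n _ hmn
    have hm' : (0 : ℝ) < 2 ^ m := by positivity
    have hmn' : (2 : ℝ) ^ m ≤ 2 ^ n := pow_le_pow_right₀ one_le_two hmn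
    have := hL ((2 : ℝ) ^ m)
    have := hL2 ((2 : ℝ) ^ m)
    have := hL ((2 : ℝ) ^ n)
    have := Log_mono hm' hmn'
    have := Log2_mono hm' hmn'
    gcongr
  have hs : Summable fun k : ℕ => 2 * (4 : ℝ) ^ (1 + ε) * (1 / (k : ℝ) ^ (1 + ε)) :=
    (Real.summable_one_div_nat_rpow.2 (by linarith)).mul_left _
  refine (summable_nat_add_iff 1).1 (Summable.of_nonneg_of_le (fun k => ?_) (fun k => ?_)
    ((summable_nat_add_iff 1).2 hs))
  · have := hL ((2 : ℝ) ^ (2 ^ (k + 1)))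
    have := hL2 ((2 : ℝ) ^ (2 ^ (k + 1)))
    positivity
  · have h1 : (2 : ℝ) ^ (k + 1) / 2 ≤ Log ((2 : ℝ) ^ (2 ^ (k + 1))) := by
      refine le_trans ?_ (le_max_right _ _)
      rw [Real.log_pow]
      push_cast
      have : (0 : ℝ) < 2 ^ (k + 1) := by positivity
      nlinarith [Real.log_two_gt_d9]
    have h2 := quarter_le_Log (k + 1)
    calc (2 : ℝ) ^ (k + 1) * (1 / (Log ((2 : ℝ) ^ (2 ^ (k + 1))) *
          Log2 ((2 : ℝ) ^ (2 ^ (k + 1))) ^ (1 + ε)))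
        ≤ (2 : ℝ) ^ (k + 1) * (1 / ((2 : ℝ) ^ (k + 1) / 2 *
          (((k + 1 : ℕ) : ℝ) / 4) ^ (1 + ε))) := by
          have : (0 : ℝ) < ((k + 1 : ℕ) : ℝ) := by positivity
          have := (hL ((2 : ℝ) ^ (2 ^ (k + 1)))).le
          unfold Log2
          gcongr
      _ = _ := by
          rw [Real.div_rpow (by positivity) (by norm_num)]
          field_simp

/-- The threshold `1 / (D_N * log N * (log₂ N) ^ (1 + ε))`. -/
noncomputable def gapBound (a : ℕ → ℝ) (ε : ℝ) (N : ℕ) : ℝ :=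
  1 / ((Dcard a N : ℝ) * Log (N : ℝ) * Log2 (N : ℝ) ^ (1 + ε))

lemma gapBound_nonneg (a : ℕ → ℝ) (ε : ℝ) (N : ℕ) : 0 ≤ gapBound a ε N := by
  have := one_pos.trans_le (one_le_Log N)
  have := one_pos.trans_le (one_le_Log2 N)
  unfold gapBound
  positivity

lemma gapBound_anti (a : ℕ → ℝ) {ε : ℝ} (hε : 0 < ε) {M N : ℕ} (hM : 2 ≤ M) (h : M ≤ N) :
    gapBound a ε N ≤ gapBound a ε M := by
  have hM' : (0 : ℝ) < M := by positivity
  have hMN : (M : ℝ) ≤ N := by exact_mod_cast h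
  have h1 : (0 : ℝ) < Dcard a M := by exact_mod_cast Dcard_pos a hM
  have h2 : (Dcard a M : ℝ) ≤ Dcard a N := by exact_mod_cast Dcard_mono a h
  have := one_pos.trans_le (one_le_Log M)
  have := one_pos.trans_le (one_le_Log N)
  have := one_pos.trans_le (one_le_Log2 M)
  have := Log_mono hM' hMN
  have := Log2_mono hM' hMN
  unfold gapBound
  gcongr

lemma tendsto_gapBound (a : ℕ → ℝ) {ε : ℝ} (hε : 0 < ε) :
    Tendsto (gapBound a ε) atTop (nhds 0) := by
  have hlog : Tendsto (fun N : ℕ => (Real.log N)⁻¹) atTop (nhds 0) :=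
    (Real.tendsto_log_atTop.comp tendsto_natCast_atTop_atTop).inv_tendsto_atTop
  refine squeeze_zero' (Eventually.of_forall (gapBound_nonneg a ε)) ?_ hlog
  filter_upwards [eventually_ge_atTop 2] with N hN
  have h1 : (1 : ℝ) ≤ Dcard a N := by exact_mod_cast Dcard_pos a hN
  have h2 : 0 < Real.log N := Real.log_pos (by exact_mod_cast hN)
  have h3 : Real.log N ≤ Log N := le_max_right _ _
  have h4 : 1 ≤ Log2 (N : ℝ) ^ (1 + ε) := Real.one_le_rpow (one_le_Log2 _) (by linarith)
  rw [gapBound, one_div]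
  gcongr
  calc Real.log N ≤ 1 * Log N * 1 := by linarith
    _ ≤ _ := by
      have := h2.trans_le h3
      gcongr

lemma gapBound_le (a : ℕ → ℝ) {ε : ℝ} (hε : 0 < ε) {N k : ℕ} (hk : 0 < k)
    (hkN : k ≤ Dcard a N) :
    gapBound a ε N ≤
      2 * 2 ^ (1 + ε) * (1 / ((k : ℝ) * Log k * Log2 k ^ (1 + ε))) := by
  have hk' : (0 : ℝ) < k := by exact_mod_cast hk
  have hsq : (k : ℝ) ≤ (N : ℝ) ^ 2 := by exact_mod_cast hkN.trans (Dcard_le_sq a N)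
  have hkD : (k : ℝ) ≤ Dcard a N := by exact_mod_cast hkN
  have h1 := Log_le_two_mul_of_le_sq hk' hsq
  have h2 := Log2_le_two_mul_of_le_sq hk' hsq
  have p1 := one_pos.trans_le (one_le_Log k)
  have p2 := one_pos.trans_le (one_le_Log2 k)
  have p3 := one_pos.trans_le (one_le_Log N)
  have p4 := one_pos.trans_le (one_le_Log2 N)
  have hD := hk'.trans_le hkD
  calc gapBound a ε N = 2 * 2 ^ (1 + ε) *
        (1 / ((Dcard a N : ℝ) * (2 * Log N) * (2 * Log2 N) ^ (1 + ε))) := by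
        rw [gapBound, Real.mul_rpow zero_le_two p4.le]
        field_simp
    _ ≤ _ := by gcongr

lemma summable_card_mul_gapBound (a : ℕ → ℝ) {ε : ℝ} (hε : 0 < ε) :
    Summable fun n : ℕ => ((Dcard a (n + 1) - Dcard a n : ℕ) : ℝ) * gapBound a ε (n + 1) := by
  set φ : ℕ → ℝ := fun k => 2 * 2 ^ (1 + ε) * (1 / ((k : ℝ) * Log k * Log2 k ^ (1 + ε)))
  have hφ : Summable φ := (summable_one_div_mul_Log_mul_Log2_rpow hε).mul_left _
  have hφ0 : ∀ k, 0 ≤ φ k := fun k => by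
    have := one_pos.trans_le (one_le_Log k)
    have := one_pos.trans_le (one_le_Log2 k)
    simp only [φ]
    positivity
  refine summable_of_sum_range_le (c := ∑' k, φ k)
    (fun n => mul_nonneg (Nat.cast_nonneg _) (gapBound_nonneg _ _ _)) fun M => ?_
  have h : ∀ M, ∑ n ∈ Finset.range M,
      ((Dcard a (n + 1) - Dcard a n : ℕ) : ℝ) * gapBound a ε (n + 1) ≤
        ∑ k ∈ Finset.Ioc (Dcard a 0) (Dcard a M), φ k := by
    intro M
    induction M with
    | zero => simp
    | succ M ih =>
      rw [Finset.sum_range_succ, ← Finset.sum_Ioc_consecutive φ (Dcard_mono a (Nat.zero_le M))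
        (Dcard_mono a (Nat.le_succ M))]
      refine add_le_add ih ?_
      rw [← Nat.card_Ioc, ← nsmul_eq_mul]
      refine Finset.card_nsmul_le_sum _ _ _ fun k hk => ?_
      rw [Finset.mem_Ioc] at hk
      exact gapBound_le a hε (by omega) hk.2
  exact (h M).trans (hφ.sum_le_tsum _ fun k _ => hφ0 k)

lemma nint_le (x : ℝ) (z : ℤ) : nint x ≤ |x - z| := round_le x z

lemma nint_neg_le (x : ℝ) : nint (-x) ≤ nint x := by
  refine (nint_le (-x) (-round x)).trans_eq ?_
  rw [nint, ← abs_neg]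
  push_cast
  congr 1
  ring

lemma nint_mul_abs (x y : ℝ) : nint (x * |y|) = nint (x * y) := by
  rcases abs_choice y with h | h <;> rw [h]
  rw [mul_neg]
  exact le_antisymm (nint_neg_le _) (by simpa using nint_neg_le (-(x * y)))

/-- The set of `α ∈ [0, 1]` for which `α * d` is `δ`-close to an integer has measure `O(δ)`. -/
lemma volume_nint_mul_lt_le {c d δ : ℝ} (hc : 0 < c) (hd : c ≤ d) (hδ : 0 ≤ δ) :
    volume.restrict (Set.Icc (0 : ℝ) 1) {α : ℝ | nint (α * d) < δ} ≤
      ENNReal.ofReal (2 * (1 + 2 / c) * δ) := by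
  have hd0 : 0 < d := hc.trans_le hd
  rw [Measure.restrict_apply' measurableSet_Icc]
  have hsub : {α : ℝ | nint (α * d) < δ} ∩ Set.Icc 0 1 ⊆
      ⋃ j ∈ Finset.range (⌊d⌋₊ + 2), Metric.ball ((j : ℝ) / d) (δ / d) := by
    rintro α ⟨hα, h0, h1⟩
    simp only [Set.mem_ofPred_eq, nint] at hα
    have hr := abs_le.1 (abs_sub_round (α * d))
    have hαd : α * d ≤ d := by nlinarith
    have hαd0 : 0 ≤ α * d := by positivity
    have hr0 : 0 ≤ round (α * d) := by
      have : (-1 : ℝ) < round (α * d) := by linarith [hr.2]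
      have : (-1 : ℤ) < round (α * d) := by exact_mod_cast this
      omega
    obtain ⟨j, hj⟩ := Int.eq_ofNat_of_zero_le hr0
    rw [hj] at hα hr
    simp only [Int.cast_natCast] at hα hr
    have hjd : (j : ℝ) < ((⌊d⌋₊ + 2 : ℕ) : ℝ) := by
      push_cast
      linarith [Nat.lt_floor_add_one d, hr.1]
    simp only [Set.mem_iUnion, Finset.mem_range, exists_prop]
    refine ⟨j, by exact_mod_cast hjd, ?_⟩
    rw [Metric.mem_ball, Real.dist_eq, lt_div_iff₀ hd0, ← abs_of_pos hd0, ← abs_mul,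
      abs_of_pos hd0, sub_mul, div_mul_cancel₀ _ hd0.ne']
    exact hα
  calc volume ({α : ℝ | nint (α * d) < δ} ∩ Set.Icc 0 1)
      ≤ ∑ j ∈ Finset.range (⌊d⌋₊ + 2), volume (Metric.ball ((j : ℝ) / d) (δ / d)) :=
        (measure_mono hsub).trans (measure_biUnion_finset_le _ _)
    _ = ENNReal.ofReal ((⌊d⌋₊ + 2 : ℕ) * (2 * (δ / d))) := by
        simp only [Real.volume_ball, Finset.sum_const, Finset.card_range, nsmul_eq_mul]
        rw [ENNReal.ofReal_mul (Nat.cast_nonneg _), ENNReal.ofReal_natCast]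
    _ ≤ _ := by
        refine ENNReal.ofReal_le_ofReal ?_
        have h1 := Nat.floor_le hd0.le
        calc ((⌊d⌋₊ + 2 : ℕ) : ℝ) * (2 * (δ / d)) ≤ (d + 2) * (2 * (δ / d)) := by
              push_cast
              gcongr
          _ = 2 * (1 + 2 / d) * δ := by field_simp
          _ ≤ _ := by gcongr

/-- The `α` for which some difference first occurring at index `n + 1` is too close to `ℤ`. -/
def badSet (a : ℕ → ℝ) (ε : ℝ) (n : ℕ) : Set ℝ :=
  ⋃ d ∈ diffSet a (n + 1) \ diffSet a n, {α : ℝ | nint (α * d) < gapBound a ε (n + 1)}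

lemma volume_badSet_le {a : ℕ → ℝ} {c : ℝ} (hc : 0 < c)
    (hsep : ∀ m n, 1 ≤ m → 1 ≤ n → m ≠ n → c ≤ |a m - a n|) (ε : ℝ) (n : ℕ) :
    volume.restrict (Set.Icc (0 : ℝ) 1) (badSet a ε n) ≤ ENNReal.ofReal
      (2 * (1 + 2 / c) * (((Dcard a (n + 1) - Dcard a n : ℕ) : ℝ) * gapBound a ε (n + 1))) := by
  have hfin : (diffSet a (n + 1) \ diffSet a n).Finite := (diffSet_finite a (n + 1)).sdiff
  have hcard : hfin.toFinset.card = Dcard a (n + 1) - Dcard a n := by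
    rw [← Set.ncard_eq_toFinset_card _ hfin]
    exact Set.ncard_sdiff (diffSet_mono a n.le_succ) (diffSet_finite a n)
  have hun : badSet a ε n =
      ⋃ d ∈ hfin.toFinset, {α : ℝ | nint (α * d) < gapBound a ε (n + 1)} := by
    simp [badSet]
  rw [hun]
  calc _ ≤ ∑ d ∈ hfin.toFinset, volume.restrict (Set.Icc (0 : ℝ) 1)
        {α : ℝ | nint (α * d) < gapBound a ε (n + 1)} := measure_biUnion_finset_le _ _
    _ ≤ ∑ d ∈ hfin.toFinset, ENNReal.ofReal (2 * (1 + 2 / c) * gapBound a ε (n + 1)) := by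
        refine Finset.sum_le_sum fun d hd => ?_
        obtain ⟨⟨p, q, hp, -, hq, -, hpq, rfl⟩, -⟩ := hfin.mem_toFinset.1 hd
        exact volume_nint_mul_lt_le hc (hsep p q hp hq hpq) (gapBound_nonneg _ _ _)
    _ = _ := by
        rw [Finset.sum_const, nsmul_eq_mul, hcard, ← ENNReal.ofReal_natCast,
          ← ENNReal.ofReal_mul (Nat.cast_nonneg _)]
        congr 1
        ring

lemma ae_eventually_notMem_badSet {a : ℕ → ℝ} {c : ℝ} (hc : 0 < c)
    (hsep : ∀ m n, 1 ≤ m → 1 ≤ n → m ≠ n → c ≤ |a m - a n|) {ε : ℝ} (hε : 0 < ε) :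
    ∀ᵐ α ∂(volume.restrict (Set.Icc (0 : ℝ) 1)), ∀ᶠ n in atTop, α ∉ badSet a ε n :=
  ae_eventually_notMem <| ne_top_of_le_ne_top
    ((summable_card_mul_gapBound a hε).mul_left (2 * (1 + 2 / c))).tsum_ofReal_ne_top
    (ENNReal.tsum_le_tsum fun n => volume_badSet_le hc hsep ε n)

lemma ae_forall_nint_mul_pos {a : ℕ → ℝ} {c : ℝ} (hc : 0 < c)
    (hsep : ∀ m n, 1 ≤ m → 1 ≤ n → m ≠ n → c ≤ |a m - a n|) :
    ∀ᵐ α ∂(volume.restrict (Set.Icc (0 : ℝ) 1)), ∀ N, ∀ d ∈ diffSet a N, 0 < nint (α * d) := by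
  refine ae_restrict_of_ae ?_
  have hcount : (⋃ N, ⋃ d ∈ diffSet a N, Set.range fun z : ℤ => (z : ℝ) / d).Countable :=
    Set.countable_iUnion fun N => (diffSet_finite a N).countable.biUnion
      fun d _ => Set.countable_range _
  filter_upwards [hcount.ae_notMem volume] with α hα N d hd
  refine (abs_nonneg _).lt_of_ne fun h => hα ?_
  have hd0 : d ≠ 0 := by
    obtain ⟨p, q, hp, -, hq, -, hpq, rfl⟩ := hd
    exact (hc.trans_le (hsep p q hp hq hpq)).ne'
  simp only [Set.mem_iUnion, Set.mem_range]
  refine ⟨N, d, hd, round (α * d), ?_⟩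
  rw [div_eq_iff hd0]
  exact (sub_eq_zero.1 (abs_eq_zero.1 h.symm)).symm

theorem stmt0 (a : ℕ → ℝ) (c : ℝ) (hc : 0 < c)
    (hpos : ∀ n, 1 ≤ n → 0 < a n)
    (hdist : ∀ m n, 1 ≤ m → 1 ≤ n → m ≠ n → a m ≠ a n)
    (hsep : ∀ m n, 1 ≤ m → 1 ≤ n → m ≠ n → c ≤ |a m - a n|)
    (ε : ℝ) (hε : 0 < ε) :
    ∀ᵐ α ∂(volume.restrict (Set.Icc (0:ℝ) 1)),
      ∃ N₀ : ℕ, ∀ N, N₀ ≤ N →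
        1 / ((Dcard a N : ℝ) * Log (N : ℝ) * Log2 (N : ℝ) ^ (1 + ε)) ≤
          deltaMin a α N := by
  filter_upwards [ae_eventually_notMem_badSet hc hsep hε, ae_forall_nint_mul_pos hc hsep]
    with α hbad hnz
  obtain ⟨N₁, hN₁⟩ := eventually_atTop.1 (hbad.and (eventually_ge_atTop 2))
  have hN₁2 : 2 ≤ N₁ := (hN₁ N₁ le_rfl).2
  have hold : ∀ᶠ N in atTop, ∀ d ∈ diffSet a N₁, gapBound a ε N ≤ nint (α * d) :=
    (eventually_all_finite (diffSet_finite a N₁)).2 fun d hd =>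
      (tendsto_gapBound a hε).eventually_le_const (hnz N₁ d hd)
  have hnew : ∀ N, N₁ ≤ N → ∀ d ∈ diffSet a N,
      d ∈ diffSet a N₁ ∨ gapBound a ε N ≤ nint (α * d) := by
    intro N hN
    induction N, hN using Nat.le_induction with
    | base => exact fun d hd => Or.inl hd
    | succ N hN ih =>
      intro d hd
      by_cases hdN : d ∈ diffSet a N
      · exact (ih d hdN).imp_right (gapBound_anti a hε (hN₁2.trans hN) N.le_succ).trans
      · refine Or.inr (not_lt.1 fun hlt => (hN₁ N hN).1 ?_)
        exact Set.mem_biUnion (x := d) ⟨hd, hdN⟩ hlt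
  obtain ⟨N₂, hN₂⟩ := eventually_atTop.1 hold
  refine ⟨max N₁ N₂, fun N hN => ?_⟩
  have hNN₁ := (le_max_left _ _).trans hN
  refine le_csInf ⟨_, 1, 2, le_rfl, by omega, by omega, by omega, by omega, rfl⟩ ?_
  rintro _ ⟨m, n, hm, hmN, hn, hnN, hmn, rfl⟩
  rw [← nint_mul_abs]
  rcases hnew N hNN₁ |a m - a n| ⟨m, n, hm, hmN, hn, hnN, hmn, rfl⟩ with h | h
  · exact hN₂ N ((le_max_right _ _).trans hN) _ h
  · exact h
end

section
/- Let (a_n)_{n≥1} be a sequence of distinct positive real numbers such that inf_{1≤m≠n≤N} |a_m − a_n| ≥ 1 for all N ∈ ℕ. Then for every ε > 0 and almost all α ∈ [0,1], the inequality ⌊δ_min^α⌋(N) ≤ N^ε / H_N holds for all except finitely many N. -/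
open MeasureTheory Filter

/-- `floorDeltaMin a α N = min { ‖α ⌊|a_m − a_n|⌋‖ : 1 ≤ m ≠ n ≤ N }`. -/
noncomputable def floorDeltaMin (a : ℕ → ℝ) (α : ℝ) (N : ℕ) : ℝ :=
  sInf {d : ℝ | ∃ m n : ℕ, 1 ≤ m ∧ m ≤ N ∧ 1 ≤ n ∧ n ≤ N ∧ m ≠ n ∧
    d = nint (α * (⌊|a m - a n|⌋ : ℝ))}

/-- `Hcard a N` is the number of distinct floored positive differences
`#{ ⌊|a_m − a_n|⌋ : 1 ≤ m ≠ n ≤ N }`. -/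
noncomputable def Hcard (a : ℕ → ℝ) (N : ℕ) : ℕ :=
  Set.ncard {k : ℤ | ∃ m n : ℕ, 1 ≤ m ∧ m ≤ N ∧ 1 ≤ n ∧ n ≤ N ∧ m ≠ n ∧
    k = ⌊|a m - a n|⌋}

theorem add_one_le_mul_rpow {δ : ℝ} (hδ : 0 < δ) {p : ℕ} (hp : 2 ≤ p) (e : ℕ) :
    (e : ℝ) + 1 ≤ (1 + 1 / (δ * Real.log 2)) * (p : ℝ) ^ (δ * e) := by
  have hlog : 0 < Real.log 2 := Real.log_pos (by norm_num)
  have h1 : (2 : ℝ) ^ (δ * e) ≤ (p : ℝ) ^ (δ * e) := by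
    gcongr
    exact_mod_cast hp
  have h2 : 1 + δ * e * Real.log 2 ≤ (2 : ℝ) ^ (δ * e) := by
    rw [Real.rpow_def_of_pos (by norm_num)]
    have := Real.add_one_le_exp (Real.log 2 * (δ * e))
    linarith
  calc (e : ℝ) + 1 ≤ (1 + 1 / (δ * Real.log 2)) * (1 + δ * e * Real.log 2) := by
        have : (1 + 1 / (δ * Real.log 2)) * (1 + δ * e * Real.log 2)
            = e + 1 + (1 / (δ * Real.log 2) + δ * e * Real.log 2) := by
          field_simp
          ring
        rw [this]
        have : 0 ≤ 1 / (δ * Real.log 2) + δ * e * Real.log 2 := by positivity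
        linarith
    _ ≤ _ := by
        gcongr
        exact h2.trans h1

theorem add_one_le_rpow {δ : ℝ} (hδ : 0 < δ) {p : ℕ} (hp : (2 : ℝ) ^ (1 / δ) ≤ p) (e : ℕ) :
    (e : ℝ) + 1 ≤ (p : ℝ) ^ (δ * e) := by
  have h1 : (2 : ℝ) ≤ (p : ℝ) ^ δ := by
    calc (2 : ℝ) = ((2 : ℝ) ^ (1 / δ)) ^ δ := by
          rw [← Real.rpow_mul (by norm_num), one_div_mul_cancel hδ.ne', Real.rpow_one]
      _ ≤ _ := by gcongr
  rw [Real.rpow_mul (by positivity), Real.rpow_natCast]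
  calc (e : ℝ) + 1 ≤ 2 ^ e := by exact_mod_cast Nat.lt_two_pow_self
    _ ≤ _ := by gcongr

theorem exists_card_divisors_le_mul_rpow {δ : ℝ} (hδ : 0 < δ) :
    ∃ C : ℝ, 1 ≤ C ∧ ∀ n : ℕ, n ≠ 0 → (n.divisors.card : ℝ) ≤ C * (n : ℝ) ^ δ := by
  have hlog : 0 < Real.log 2 := Real.log_pos (by norm_num)
  set A : ℝ := 1 + 1 / (δ * Real.log 2)
  have hA : 1 ≤ A := by
    have : 0 ≤ 1 / (δ * Real.log 2) := by positivity
    simp only [A]; linarith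
  set B : ℕ := ⌈(2 : ℝ) ^ (1 / δ)⌉₊
  refine ⟨A ^ B, one_le_pow₀ hA, fun n hn => ?_⟩
  rw [Nat.card_divisors hn]
  have hprod : (n : ℝ) ^ δ = ∏ p ∈ n.primeFactors, (p : ℝ) ^ (δ * n.factorization p) := by
    conv_lhs => rw [← Nat.prod_factorization_pow_eq_self hn]
    rw [Finsupp.prod, Nat.support_factorization]
    push_cast
    rw [← Real.finsetProd_rpow _ _ (fun i _ => by positivity)]
    refine Finset.prod_congr rfl fun p _ => ?_
    rw [← Real.rpow_natCast, ← Real.rpow_mul (by positivity), mul_comm]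
  push_cast
  calc ∏ p ∈ n.primeFactors, ((n.factorization p : ℝ) + 1)
      ≤ ∏ p ∈ n.primeFactors, ((if p < B then A else 1) * (p : ℝ) ^ (δ * n.factorization p)) := by
        refine Finset.prod_le_prod (fun _ _ => by positivity) fun p hp => ?_
        split_ifs with h
        · exact add_one_le_mul_rpow hδ (Nat.prime_of_mem_primeFactors hp).two_le _
        · rw [one_mul]
          exact add_one_le_rpow hδ ((Nat.le_ceil _).trans (by exact_mod_cast not_lt.mp h)) _
    _ = A ^ (n.primeFactors.filter (· < B)).card * (n : ℝ) ^ δ := by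
        rw [Finset.prod_mul_distrib, ← hprod, Finset.prod_ite]
        simp
    _ ≤ A ^ B * (n : ℝ) ^ δ := by
        gcongr
        calc _ ≤ (Finset.range B).card := Finset.card_le_card fun p hp => by
              simp only [Finset.mem_filter] at hp
              exact Finset.mem_range.mpr hp.2
          _ = B := Finset.card_range B

/-- The number of solutions of `x * g i = y * g j` in `i` and `j`. -/
def dilateCount {I : Type} [Fintype I] (g : I → ℕ) (x y : ℕ) : ℕ :=
  (Finset.univ.filter fun q : I × I => x * g q.1 = y * g q.2).card

theorem dilateCount_le {I : Type} [Fintype I] {g : I → ℕ} {ρ : ℝ}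
    (hρ : ∀ n, ((Finset.univ.filter fun i => g i = n).card : ℝ) ≤ ρ) (x : ℕ) {y : ℕ} (hy : 0 < y) :
    (dilateCount g x y : ℝ) ≤ Fintype.card I * ρ := by
  classical
  have h : dilateCount g x y
      = ∑ i : I, (Finset.univ.filter fun j => x * g i = y * g j).card := by
    simp only [dilateCount, Finset.card_filter, Fintype.sum_prod_type]
  rw [h]
  push_cast
  calc _ ≤ ∑ _i : I, ρ := by
        refine Finset.sum_le_sum fun i _ => le_trans ?_ (hρ (x * g i / y))
        refine Nat.cast_le.mpr (Finset.card_le_card fun j hj => ?_)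
        simp only [Finset.mem_filter, Finset.mem_univ, true_and] at hj ⊢
        rw [hj, Nat.mul_div_cancel_left _ hy]
    _ = _ := by simp

theorem sum_dilateCount_mul_le {I : Type} [Fintype I] {g : I → ℕ} (hg : ∀ i, 0 < g i)
    (D : Finset ℕ) (y z : ℕ) :
    ∑ x ∈ D, dilateCount g x y * dilateCount g x z
      ≤ dilateCount (fun q : I × I => g q.1 * g q.2) y z := by
  classical
  simp only [dilateCount, ← Finset.card_product]
  rw [← Finset.card_sigma]
  refine Finset.card_le_card_of_injOn
    (fun t => ((t.2.1.2, t.2.2.1), (t.2.2.2, t.2.1.1))) ?_ ?_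
  · rintro ⟨x, ⟨i, j⟩, i', j'⟩ h
    simp only [Finset.coe_sigma, Set.mem_sigma_iff, Finset.mem_coe, Finset.mem_product,
      Finset.mem_filter, Finset.mem_univ, true_and, Finset.coe_filter, Set.mem_ofPred_eq] at h ⊢
    obtain ⟨-, h1, h2⟩ := h
    calc y * (g j * g i') = (y * g j) * g i' := by ring
      _ = (x * g i') * g i := by rw [← h1]; ring
      _ = _ := by rw [h2]; ring
  · rintro ⟨x, ⟨i, j⟩, i', j'⟩ h ⟨x₁, ⟨i₁, j₁⟩, i₁', j₁'⟩ h₁ heq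
    simp only [Finset.coe_sigma, Set.mem_sigma_iff, Finset.mem_coe, Finset.mem_product,
      Finset.mem_filter, Finset.mem_univ, true_and] at h h₁
    simp only [Prod.mk.injEq] at heq
    obtain ⟨⟨rfl, rfl⟩, rfl, rfl⟩ := heq
    have : x = x₁ := Nat.eq_of_mul_eq_mul_right (hg i) (h.2.1.trans h₁.2.1.symm)
    subst this
    rfl

/-- The number of solutions of `x * g i = y * g j` with `x, y ∈ D`. -/
def dilateEnergy {I : Type} [Fintype I] (g : I → ℕ) (D : Finset ℕ) : ℕ :=
  ∑ x ∈ D, ∑ y ∈ D, dilateCount g x y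

theorem sq_dilateEnergy_le {I : Type} [Fintype I] {g : I → ℕ} (hg : ∀ i, 0 < g i)
    (D : Finset ℕ) :
    dilateEnergy g D ^ 2 ≤ D.card * dilateEnergy (fun q : I × I => g q.1 * g q.2) D := by
  have h : ∑ x ∈ D, (∑ y ∈ D, dilateCount g x y) ^ 2
      = ∑ y ∈ D, ∑ z ∈ D, ∑ x ∈ D, dilateCount g x y * dilateCount g x z := by
    simp only [sq, Finset.sum_mul_sum]
    rw [Finset.sum_comm]
    exact Finset.sum_congr rfl fun y _ => Finset.sum_comm
  calc dilateEnergy g D ^ 2 ≤ D.card * ∑ x ∈ D, (∑ y ∈ D, dilateCount g x y) ^ 2 := by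
        have := sq_sum_le_card_mul_sum_sq (s := D)
          (f := fun x => ((∑ y ∈ D, dilateCount g x y : ℕ) : ℤ))
        unfold dilateEnergy
        exact_mod_cast this
    _ ≤ _ := by
        rw [h]
        unfold dilateEnergy
        gcongr with y _ z _
        exact sum_dilateCount_mul_le hg D y z

theorem card_mul_fiber_le {I : Type} [Fintype I] {g : I → ℕ} (hg : ∀ i, 0 < g i) {ρ : ℝ}
    (hρ : ∀ n, ((Finset.univ.filter fun i => g i = n).card : ℝ) ≤ ρ) (n : ℕ) :
    ((Finset.univ.filter fun q : I × I => g q.1 * g q.2 = n).card : ℝ)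
      ≤ n.divisors.card * ρ ^ 2 := by
  classical
  rcases Nat.eq_zero_or_pos n with rfl | hn
  · simp [(hg _).ne']
  have h : (Finset.univ.filter fun q : I × I => g q.1 * g q.2 = n) ⊆
      n.divisors.biUnion fun u => (Finset.univ.filter fun i => g i = u) ×ˢ
        (Finset.univ.filter fun i => g i = n / u) := by
    rintro ⟨i, j⟩ hq
    simp only [Finset.mem_filter, Finset.mem_univ, true_and] at hq
    simp only [Finset.mem_biUnion, Finset.mem_product, Finset.mem_filter, Finset.mem_univ,
      true_and, Nat.mem_divisors]
    refine ⟨g i, ⟨⟨_, hq.symm⟩, hn.ne'⟩, rfl, ?_⟩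
    rw [← hq, Nat.mul_div_cancel_left _ (hg i)]
  have h2 := (Finset.card_le_card h).trans Finset.card_biUnion_le
  simp only [Finset.card_product] at h2
  calc _ ≤ ((∑ u ∈ n.divisors, (Finset.univ.filter fun i => g i = u).card *
        (Finset.univ.filter fun i => g i = n / u).card : ℕ) : ℝ) := by exact_mod_cast h2
    _ ≤ ∑ _u ∈ n.divisors, ρ ^ 2 := by
        push_cast
        refine Finset.sum_le_sum fun u _ => ?_
        rw [sq]
        exact mul_le_mul (hρ _) (hρ _) (by positivity) (le_trans (by positivity) (hρ 0))
    _ = _ := by simp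

theorem exists_dilateEnergy_le (s : ℕ) : ∀ δ : ℝ, 0 < δ → ∃ C : ℝ, 1 ≤ C ∧
    ∀ (I : Type) [Fintype I] (g : I → ℕ), (∀ i, 0 < g i) → ∀ M : ℕ, 0 < M → (∀ i, g i ≤ M) →
    ∀ ρ : ℝ, (∀ n, ((Finset.univ.filter fun i => g i = n).card : ℝ) ≤ ρ) →
    ∀ D : Finset ℕ, (∀ d ∈ D, 0 < d) → (dilateEnergy g D : ℝ) ≤
      C * (D.card : ℝ) ^ (1 + (1 / 2 : ℝ) ^ s) * Fintype.card I * ρ * (M : ℝ) ^ δ := by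
  induction s with
  | zero =>
    intro δ hδ
    refine ⟨1, le_rfl, fun I _ g hg M hM hgM ρ hρ D hD => ?_⟩
    have hρ0 : 0 ≤ ρ := le_trans (by positivity) (hρ 0)
    have hMδ : 1 ≤ (M : ℝ) ^ δ := Real.one_le_rpow (by exact_mod_cast hM) hδ.le
    have hexp : (D.card : ℝ) ^ (1 + (1 / 2 : ℝ) ^ 0) = (D.card : ℝ) ^ 2 := by
      rw [pow_zero, ← Real.rpow_natCast]; norm_num
    calc (dilateEnergy g D : ℝ) = ∑ x ∈ D, ∑ y ∈ D, (dilateCount g x y : ℝ) := by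
          simp [dilateEnergy]
      _ ≤ ∑ _x ∈ D, ∑ _y ∈ D, Fintype.card I * ρ :=
          Finset.sum_le_sum fun x _ => Finset.sum_le_sum fun y hy => dilateCount_le hρ x (hD y hy)
      _ = 1 * (D.card : ℝ) ^ 2 * Fintype.card I * ρ * 1 := by simp; ring
      _ ≤ _ := by rw [hexp]; gcongr
  | succ s ih =>
    intro δ hδ
    obtain ⟨C, hC, hE⟩ := ih (δ / 2) (by positivity)
    obtain ⟨C', hC', hdiv⟩ := exists_card_divisors_le_mul_rpow (δ := δ / 2) (by positivity)
    refine ⟨C * C', one_le_mul_of_one_le_of_one_le hC hC', fun I _ g hg M hM hgM ρ hρ D hD => ?_⟩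
    have hρ0 : 0 ≤ ρ := le_trans (by positivity) (hρ 0)
    have hgM2 : ∀ q : I × I, g q.1 * g q.2 ≤ M ^ 2 := fun q => by
      rw [sq]; exact Nat.mul_le_mul (hgM _) (hgM _)
    have hM2 : ((M ^ 2 : ℕ) : ℝ) ^ (δ / 2) = (M : ℝ) ^ δ := by
      push_cast
      rw [← Real.rpow_natCast, ← Real.rpow_mul (by positivity)]
      congr 1; push_cast; ring
    have key := hE (I × I) (fun q => g q.1 * g q.2) (fun q => mul_pos (hg _) (hg _)) (M ^ 2)
      (by positivity) hgM2 (C' * (M : ℝ) ^ δ * ρ ^ 2) (fun n => by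
        by_cases hn : n ≠ 0 ∧ n ≤ M ^ 2
        · refine (card_mul_fiber_le hg hρ n).trans ?_
          gcongr
          refine (hdiv n hn.1).trans ?_
          rw [← hM2]
          gcongr
          exact hn.2
        · have : (Finset.univ.filter fun q : I × I => g q.1 * g q.2 = n) = ∅ := by
            refine Finset.filter_false_of_mem fun q _ hq => hn ⟨?_, hq ▸ hgM2 q⟩
            rw [← hq]
            exact (mul_pos (hg _) (hg _)).ne'
          rw [this]
          simp only [Finset.card_empty, Nat.cast_zero]
          positivity) D hD
    rw [hM2, Fintype.card_prod] at key
    have hsq : (dilateEnergy g D : ℝ) ^ 2 ≤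
        D.card * dilateEnergy (fun q : I × I => g q.1 * g q.2) D := by
      exact_mod_cast sq_dilateEnergy_le hg D
    have hH : (D.card : ℝ) * (D.card : ℝ) ^ (1 + (1 / 2 : ℝ) ^ s)
        = ((D.card : ℝ) ^ (1 + (1 / 2 : ℝ) ^ (s + 1))) ^ 2 := by
      rw [← Real.rpow_natCast (_ ^ _) 2, ← Real.rpow_mul (by positivity)]
      nth_rewrite 1 [← Real.rpow_one (D.card : ℝ)]
      rw [← Real.rpow_add_of_nonneg (by positivity) (by positivity) (by positivity)]
      congr 1; push_cast; ring
    refine le_of_sq_le_sq (hsq.trans ((mul_le_mul_of_nonneg_left key (by positivity)).trans ?_))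
      (by positivity)
    push_cast
    calc _ = (C * C') * (((D.card : ℝ) * (D.card : ℝ) ^ (1 + (1 / 2 : ℝ) ^ s)) *
          (Fintype.card I * ρ * (M : ℝ) ^ δ) ^ 2) := by ring
      _ ≤ (C * C') ^ 2 * (((D.card : ℝ) * (D.card : ℝ) ^ (1 + (1 / 2 : ℝ) ^ s)) *
          (Fintype.card I * ρ * (M : ℝ) ^ δ) ^ 2) := by
          gcongr
          exact le_self_pow₀ (one_le_mul_of_one_le_of_one_le hC hC') two_ne_zero
      _ = _ := by rw [hH]; ring


theorem integral_cos_two_pi_int_mul (n : ℤ) :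
    ∫ x in (0 : ℝ)..1, Real.cos (2 * Real.pi * n * x) = if n = 0 then 1 else 0 := by
  split_ifs with h
  · simp [h]
  · have hc : 2 * Real.pi * n ≠ 0 := by
      have : (n : ℝ) ≠ 0 := by exact_mod_cast h
      positivity
    rw [intervalIntegral.integral_comp_mul_left (fun x => Real.cos x) hc, integral_cos]
    have : Real.sin (2 * Real.pi * n) = 0 := by
      rw [show 2 * Real.pi * n = ((2 * n : ℤ) : ℝ) * Real.pi by push_cast; ring]
      exact Real.sin_int_mul_pi _
    simp [this]

theorem integral_cos_mul_cos {a b : ℕ} (ha : 0 < a) :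
    ∫ x in (0 : ℝ)..1, Real.cos (2 * Real.pi * a * x) * Real.cos (2 * Real.pi * b * x)
      = if a = b then 1 / 2 else 0 := by
  have h : ∀ x : ℝ, Real.cos (2 * Real.pi * a * x) * Real.cos (2 * Real.pi * b * x)
      = (1 / 2) * Real.cos (2 * Real.pi * ((a - b : ℤ) : ℝ) * x)
        + (1 / 2) * Real.cos (2 * Real.pi * ((a + b : ℤ) : ℝ) * x) := fun x => by
    push_cast
    rw [show 2 * Real.pi * ((a : ℝ) - b) * x = 2 * Real.pi * a * x - 2 * Real.pi * b * x by ring,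
      show 2 * Real.pi * ((a : ℝ) + b) * x = 2 * Real.pi * a * x + 2 * Real.pi * b * x by ring,
      Real.cos_sub, Real.cos_add]
    ring
  simp only [h]
  rw [intervalIntegral.integral_add (Continuous.intervalIntegrable (by fun_prop) _ _)
    (Continuous.intervalIntegrable (by fun_prop) _ _), intervalIntegral.integral_const_mul,
    intervalIntegral.integral_const_mul, integral_cos_two_pi_int_mul, integral_cos_two_pi_int_mul]
  have h1 : (a : ℤ) + b ≠ 0 := by omega
  have h2 : ((a : ℤ) - b = 0) ↔ a = b := by omega
  simp only [h1, h2, if_false]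
  split_ifs <;> norm_num

theorem integral_sq_sum_cos {J : Type} (S : Finset J) (c : J → ℝ) (a : J → ℕ)
    (ha : ∀ j ∈ S, 0 < a j) :
    ∫ x in (0 : ℝ)..1, (∑ j ∈ S, c j * Real.cos (2 * Real.pi * a j * x)) ^ 2
      = ∑ j ∈ S, ∑ k ∈ S, if a j = a k then c j * c k / 2 else 0 := by
  simp only [sq, Finset.sum_mul_sum]
  rw [intervalIntegral.integral_finsetSum fun j _ =>
    Continuous.intervalIntegrable (by fun_prop) _ _]
  refine Finset.sum_congr rfl fun j hj => ?_
  rw [intervalIntegral.integral_finsetSum fun k _ =>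
    Continuous.intervalIntegrable (by fun_prop) _ _]
  refine Finset.sum_congr rfl fun k _ => ?_
  rw [show (fun x : ℝ => c j * Real.cos (2 * Real.pi * a j * x) *
        (c k * Real.cos (2 * Real.pi * a k * x))) = fun x => (c j * c k) *
        (Real.cos (2 * Real.pi * a j * x) * Real.cos (2 * Real.pi * a k * x)) by ext; ring,
    intervalIntegral.integral_const_mul, integral_cos_mul_cos (ha j hj)]
  split_ifs <;> ring

/-- The squared modulus of a trigonometric polynomial as a cosine polynomial. -/
theorem exists_normSq_eq_sum_cos (p : ℕ → ℝ) (M : ℕ) :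
    ∃ c : ℕ → ℝ, (c 0 = ∑ i ∈ Finset.range M, p i ^ 2) ∧ (∀ k, |c k| ≤ 2 * c 0) ∧
      ∀ x : ℝ, Complex.normSq (∑ i ∈ Finset.range M,
          (p i : ℂ) * Complex.exp (Complex.I * (2 * Real.pi * x : ℝ)) ^ i)
        = ∑ k ∈ Finset.range M, c k * Real.cos (2 * Real.pi * k * x) := by
  set R := Finset.range M
  set c : ℕ → ℝ := fun k => ∑ q ∈ (R ×ˢ R).filter (fun q => Nat.dist q.1 q.2 = k), p q.1 * p q.2
  have h0 : c 0 = ∑ i ∈ R, p i ^ 2 := by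
    simp only [c]
    rw [Finset.sum_filter, Finset.sum_product]
    refine Finset.sum_congr rfl fun i hi => ?_
    have : ∀ j, (Nat.dist i j = 0) ↔ i = j := fun j =>
      ⟨Nat.eq_of_dist_eq_zero, fun h => Nat.dist_eq_zero h⟩
    simp [this, hi, sq]
  have hcount : ∀ k i, (R.filter fun j => Nat.dist i j = k).card ≤ 2 := fun k i => by
    refine (Finset.card_le_card (t := {i + k, i - k}) fun j hj => ?_).trans Finset.card_le_two
    have hj := (Finset.mem_filter.mp hj).2
    unfold Nat.dist at hj
    simp only [Finset.mem_insert, Finset.mem_singleton]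
    omega
  have hsum : ∀ k, ∑ q ∈ (R ×ˢ R).filter (fun q => Nat.dist q.1 q.2 = k), p q.1 ^ 2
      ≤ 2 * ∑ i ∈ R, p i ^ 2 := fun k => by
    rw [Finset.sum_filter, Finset.sum_product, Finset.mul_sum]
    refine Finset.sum_le_sum fun i _ => ?_
    rw [← Finset.sum_filter]
    simp only [Finset.sum_const, nsmul_eq_mul]
    gcongr
    exact_mod_cast hcount k i
  have hsum' : ∀ k, ∑ q ∈ (R ×ˢ R).filter (fun q => Nat.dist q.1 q.2 = k), p q.2 ^ 2
      ≤ 2 * ∑ i ∈ R, p i ^ 2 := fun k => by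
    rw [Finset.sum_filter, Finset.sum_product_right, Finset.mul_sum]
    refine Finset.sum_le_sum fun i _ => ?_
    rw [← Finset.sum_filter]
    simp only [Finset.sum_const, nsmul_eq_mul]
    gcongr
    have := hcount k i
    simp only [Nat.dist_comm i] at this
    exact_mod_cast this
  refine ⟨c, h0, fun k => ?_, fun x => ?_⟩
  · rw [h0]
    calc |c k| ≤ ∑ q ∈ (R ×ˢ R).filter (fun q => Nat.dist q.1 q.2 = k), |p q.1 * p q.2| :=
          Finset.abs_sum_le_sum_abs _ _
      _ ≤ ∑ q ∈ (R ×ˢ R).filter (fun q => Nat.dist q.1 q.2 = k),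
          (p q.1 ^ 2 / 2 + p q.2 ^ 2 / 2) := by
          refine Finset.sum_le_sum fun q _ => ?_
          rw [abs_le]
          constructor <;> nlinarith [sq_nonneg (p q.1 + p q.2), sq_nonneg (p q.1 - p q.2)]
      _ ≤ _ := by
          rw [Finset.sum_add_distrib, ← Finset.sum_div, ← Finset.sum_div]
          linarith [hsum k, hsum' k]
  · have hre : ∀ i : ℕ, (p i : ℂ) * Complex.exp (Complex.I * (2 * Real.pi * x : ℝ)) ^ i
        = ⟨p i * Real.cos (2 * Real.pi * i * x), p i * Real.sin (2 * Real.pi * i * x)⟩ := by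
      intro i
      rw [← Complex.exp_nat_mul,
        show (i : ℂ) * (Complex.I * (2 * Real.pi * x : ℝ))
          = ((2 * Real.pi * i * x : ℝ) : ℂ) * Complex.I by push_cast; ring,
        Complex.exp_mul_I, ← Complex.ofReal_cos, ← Complex.ofReal_sin]
      apply Complex.ext <;> simp [-Complex.ofReal_cos, -Complex.ofReal_sin]
    have hexp : Complex.normSq (∑ i ∈ R,
          (p i : ℂ) * Complex.exp (Complex.I * (2 * Real.pi * x : ℝ)) ^ i)
        = ∑ q ∈ R ×ˢ R, p q.1 * p q.2 * Real.cos (2 * Real.pi * (Nat.dist q.1 q.2) * x) := by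
      simp only [hre, Complex.normSq_apply, Complex.re_sum, Complex.im_sum]
      rw [Finset.sum_mul_sum, Finset.sum_mul_sum, Finset.sum_product, ← Finset.sum_add_distrib]
      refine Finset.sum_congr rfl fun i _ => ?_
      rw [← Finset.sum_add_distrib]
      refine Finset.sum_congr rfl fun j _ => ?_
      have : Real.cos (2 * Real.pi * (Nat.dist i j) * x)
          = Real.cos (2 * Real.pi * i * x - 2 * Real.pi * j * x) := by
        rcases le_total i j with h | h
        · rw [Nat.dist_eq_sub_of_le h, Nat.cast_sub h, ← Real.cos_neg]
          congr 1; ring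
        · rw [Nat.dist_eq_sub_of_le_right h, Nat.cast_sub h]
          congr 1; ring
      rw [this, Real.cos_sub]
      ring
    rw [hexp, ← Finset.sum_fiberwise_of_maps_to (t := R) (g := fun q => Nat.dist q.1 q.2)]
    · refine Finset.sum_congr rfl fun k _ => ?_
      simp only [c, Finset.sum_mul]
      refine Finset.sum_congr rfl fun q hq => ?_
      rw [(Finset.mem_filter.mp hq).2]
    · intro q hq
      simp only [R, Finset.mem_product, Finset.mem_range, Nat.dist] at hq ⊢
      omega

theorem two_mul_abs_sub_round_le_abs_sin (x : ℝ) : 2 * |x - round x| ≤ |Real.sin (Real.pi * x)| := by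
  have h1 : |Real.sin (Real.pi * x)| = |Real.sin (Real.pi * (x - round x))| := by
    rw [show Real.pi * (x - round x) = Real.pi * x - (round x : ℤ) * Real.pi by ring,
      Real.sin_sub_int_mul_pi, abs_mul]
    simp
  have h2 : |Real.pi * (x - round x)| ≤ Real.pi / 2 := by
    rw [abs_mul, abs_of_pos Real.pi_pos]
    nlinarith [Real.pi_pos, abs_sub_round x]
  have h3 := Real.mul_abs_le_abs_sin h2
  rw [abs_mul, abs_of_pos Real.pi_pos] at h3
  rw [h1]
  refine le_trans (le_of_eq ?_) h3
  field_simp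

theorem norm_geom_sum_exp_mul_le (K : ℕ) (x : ℝ) :
    ‖∑ j ∈ Finset.range K, Complex.exp (Complex.I * (2 * Real.pi * x : ℝ)) ^ j‖
      * (2 * |x - round x|) ≤ 1 := by
  set z := Complex.exp (Complex.I * (2 * Real.pi * x : ℝ)) with hz
  have hz1 : ‖z‖ = 1 := Complex.norm_exp_I_mul_ofReal _
  have h1 : ‖z - 1‖ = 2 * |Real.sin (Real.pi * x)| := by
    rw [hz, Complex.norm_exp_I_mul_ofReal_sub_one, norm_mul, Real.norm_eq_abs, Real.norm_eq_abs,
      show 2 * Real.pi * x / 2 = Real.pi * x by ring]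
    norm_num
  have h2 : ‖∑ j ∈ Finset.range K, z ^ j‖ * ‖z - 1‖ ≤ 2 := by
    rw [← norm_mul, geom_sum_mul]
    refine (norm_sub_le _ _).trans ?_
    rw [norm_pow, hz1]
    norm_num
  rw [h1] at h2
  have := mul_le_mul_of_nonneg_left (two_mul_abs_sub_round_le_abs_sin x)
    (norm_nonneg (∑ j ∈ Finset.range K, z ^ j))
  linarith

/-- A power of the Fejér kernel as a cosine polynomial. -/
theorem exists_fejer_pow_eq_sum_cos (K r : ℕ) (hK : 0 < K) (hr : 0 < r) :
    ∃ c : ℕ → ℝ, ((K : ℝ) ^ (2 * r) ≤ (r * K : ℕ) * c 0) ∧ (∀ k, |c k| ≤ 2 * c 0) ∧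
      ∀ x : ℝ, ‖∑ j ∈ Finset.range K,
          Complex.exp (Complex.I * (2 * Real.pi * x : ℝ)) ^ j‖ ^ (2 * r)
        = ∑ k ∈ Finset.range (r * K), c k * Real.cos (2 * Real.pi * k * x) := by
  set P : Polynomial ℝ := (∑ j ∈ Finset.range K, Polynomial.X ^ j) ^ r
  have hdeg : P.natDegree < r * K := by
    have h1 : (∑ j ∈ Finset.range K, (Polynomial.X : Polynomial ℝ) ^ j).natDegree ≤ K - 1 := by
      refine Polynomial.natDegree_sum_le_of_forall_le _ _ fun j hj => ?_
      have := Finset.mem_range.mp hj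
      rw [Polynomial.natDegree_X_pow]
      omega
    have h2 : P.natDegree ≤ r * (K - 1) := Polynomial.natDegree_pow_le_of_le r h1
    have h3 : r * (K - 1) < r * K := by gcongr; omega
    omega
  obtain ⟨c, hc0, hc, hx⟩ := exists_normSq_eq_sum_cos P.coeff (r * K)
  refine ⟨c, ?_, hc, fun x => ?_⟩
  · have h1 : P.eval 1 = (K : ℝ) ^ r := by simp [P, Polynomial.eval_finsetSum]
    rw [Polynomial.eval_eq_sum_range' hdeg] at h1
    simp only [one_pow, mul_one] at h1
    have := sq_sum_le_card_mul_sum_sq (s := Finset.range (r * K)) (f := P.coeff)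
    rw [h1, ← hc0, Finset.card_range] at this
    rw [mul_comm 2 r, pow_mul]
    exact this
  · rw [← hx]
    set z := Complex.exp (Complex.I * (2 * Real.pi * x : ℝ))
    have h1 : ∑ i ∈ Finset.range (r * K), (P.coeff i : ℂ) * z ^ i
        = (∑ j ∈ Finset.range K, z ^ j) ^ r := by
      have := Polynomial.eval_eq_sum_range' (p := P.map (algebraMap ℝ ℂ))
        (lt_of_le_of_lt Polynomial.natDegree_map_le hdeg) z
      simp only [Polynomial.coeff_map] at this
      rw [show ∑ i ∈ Finset.range (r * K), (P.coeff i : ℂ) * z ^ i = _ from this.symm]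
      simp [P, Polynomial.map_sum, Polynomial.eval_finsetSum, Polynomial.map_pow]
    rw [h1, Complex.normSq_eq_norm_sq, norm_pow, ← pow_mul, mul_comm 2 r]

theorem volume_real_forall_lt_nint_le {D : Finset ℕ} (hD : ∀ d ∈ D, 0 < d) (hne : D.Nonempty)
    {ψ : ℝ} (hψ : 0 < ψ) {K r : ℕ} (hK : 0 < K) (hr : 0 < r)
    (h : (2 * (r * K : ℕ) : ℝ) ≤ (2 * K * ψ) ^ (2 * r)) :
    (volume.restrict (Set.Icc (0 : ℝ) 1)).real {x | ∀ d ∈ D, ψ < nint (x * d)}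
      ≤ 8 * dilateEnergy (fun i : Fin (r * K - 1) => (i : ℕ) + 1) D / (D.card : ℝ) ^ 2 := by
  obtain ⟨c, hc0, hc, hf⟩ := exists_fejer_pow_eq_sum_cos K r hK hr
  have hMpos : 0 < r * K := Nat.mul_pos hr hK
  have hMR : (0 : ℝ) < (r * K : ℕ) := by exact_mod_cast hMpos
  have hH : (0 : ℝ) < D.card := by exact_mod_cast hne.card_pos
  have hcpos : 0 < c 0 := by
    have : (0 : ℝ) < (K : ℝ) ^ (2 * r) := by positivity
    exact pos_of_mul_pos_right (this.trans_le hc0) hMR.le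
  set g : Fin (r * K - 1) → ℕ := fun i => (i : ℕ) + 1
  set S : Finset (ℕ × Fin (r * K - 1)) := D ×ˢ Finset.univ
  set Y : ℝ → ℝ := fun x => ∑ q ∈ S, c (g q.2) *
    Real.cos (2 * Real.pi * ((q.1 * g q.2 : ℕ) : ℝ) * x)
  have hX : ∀ x, Y x = ∑ d ∈ D, (‖∑ j ∈ Finset.range K,
      Complex.exp (Complex.I * (2 * Real.pi * (x * d) : ℝ)) ^ j‖ ^ (2 * r) - c 0) := by
    intro x
    simp only [Y, S]
    rw [Finset.sum_product]
    refine Finset.sum_congr rfl fun d _ => ?_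
    have hsplit : ∀ F : ℕ → ℝ, ∑ k ∈ Finset.range (r * K), F k
        = ∑ i : Fin (r * K - 1), F (i + 1) + F 0 := fun F => by
      rw [← Finset.sum_range fun i => F (i + 1), ← Finset.sum_range_succ',
        Nat.sub_add_cancel hMpos]
    rw [hf, hsplit]
    simp only [Nat.cast_zero, mul_zero, zero_mul, Real.cos_zero, mul_one, add_sub_cancel_right]
    refine Finset.sum_congr rfl fun i _ => ?_
    simp only [g]
    congr 2
    push_cast
    ring
  have hbad : {x | ∀ d ∈ D, ψ < nint (x * d)} ⊆ {x | (c 0 * D.card / 2) ^ 2 ≤ Y x ^ 2} := by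
    intro x hx
    have hle : Y x ≤ ∑ _d ∈ D, -(c 0 / 2) := by
      rw [hX]
      refine Finset.sum_le_sum fun d hd => ?_
      have h1 := norm_geom_sum_exp_mul_le K (x * d)
      set w := ‖∑ j ∈ Finset.range K, Complex.exp (Complex.I * (2 * Real.pi * (x * d) : ℝ)) ^ j‖
      have hw : 0 ≤ w := norm_nonneg _
      have h2 : w * (2 * ψ) ≤ 1 := by
        refine le_trans ?_ h1
        gcongr
        exact (hx d hd).le
      have h3 : w ^ (2 * r) * (2 * K * ψ) ^ (2 * r) ≤ (K : ℝ) ^ (2 * r) := by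
        rw [← mul_pow]
        gcongr
        calc w * (2 * K * ψ) = w * (2 * ψ) * K := by ring
          _ ≤ 1 * K := by gcongr
          _ = K := one_mul _
      have h4 : w ^ (2 * r) * (2 * (r * K : ℕ)) ≤ (r * K : ℕ) * c 0 :=
        (mul_le_mul_of_nonneg_left h (by positivity)).trans (h3.trans hc0)
      have h5 : w ^ (2 * r) * 2 ≤ c 0 := by
        refine le_of_mul_le_mul_left ?_ hMR
        linarith
      linarith
    rw [Finset.sum_const, nsmul_eq_mul] at hle
    have : 0 ≤ c 0 * D.card / 2 := by positivity
    simp only [Set.mem_ofPred_eq]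
    nlinarith
  have hcont : Continuous Y := by fun_prop
  have hint : Integrable (fun x => Y x ^ 2) (volume.restrict (Set.Icc (0 : ℝ) 1)) :=
    (hcont.pow 2).continuousOn.integrableOn_Icc
  have hvar : ∫ x in Set.Icc (0 : ℝ) 1, Y x ^ 2 ≤ 2 * c 0 ^ 2 * dilateEnergy g D := by
    rw [integral_Icc_eq_integral_Ioc, ← intervalIntegral.integral_of_le zero_le_one]
    simp only [Y]
    rw [integral_sq_sum_cos S (fun q => c (g q.2)) (fun q => q.1 * g q.2) (fun q hq =>
      Nat.mul_pos (hD _ (Finset.mem_product.mp hq).1) (Nat.succ_pos _))]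
    have hE : (dilateEnergy g D : ℝ)
        = ∑ q ∈ S, ∑ q' ∈ S, if q.1 * g q.2 = q'.1 * g q'.2 then 1 else 0 := by
      simp only [dilateEnergy, dilateCount, S, Finset.sum_product, Finset.card_filter,
        Fintype.sum_prod_type]
      push_cast
      exact Finset.sum_congr rfl fun x _ => Finset.sum_comm
    rw [hE, Finset.mul_sum]
    refine Finset.sum_le_sum fun q _ => ?_
    rw [Finset.mul_sum]
    refine Finset.sum_le_sum fun q' _ => ?_
    split_ifs
    · have h1 := (le_abs_self _).trans (abs_mul (c (g q.2)) (c (g q'.2))).le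
      have h2 := mul_le_mul (hc (g q.2)) (hc (g q'.2)) (abs_nonneg _) (by positivity)
      nlinarith
    · simp
  have hmark := mul_meas_ge_le_integral_of_nonneg
    (Eventually.of_forall fun x => sq_nonneg (Y x)) hint ((c 0 * D.card / 2) ^ 2)
  have hmono : (volume.restrict (Set.Icc (0 : ℝ) 1)).real {x | ∀ d ∈ D, ψ < nint (x * d)} ≤
      (volume.restrict (Set.Icc (0 : ℝ) 1)).real {x | (c 0 * D.card / 2) ^ 2 ≤ Y x ^ 2} :=
    measureReal_mono hbad
  rw [le_div_iff₀ (by positivity)]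
  have h1 := (mul_le_mul_of_nonneg_left hmono (sq_nonneg (c 0 * D.card / 2))).trans
    (hmark.trans hvar)
  refine le_of_mul_le_mul_left ?_ (show 0 < c 0 ^ 2 / 4 by positivity)
  linarith

theorem exists_volume_real_forall_lt_nint_le {η : ℝ} (hη : 0 < η) (hη1 : η < 1) :
    ∃ C : ℝ, 0 < C ∧ ∀ D : Finset ℕ, (∀ d ∈ D, 0 < d) → D.Nonempty →
      (volume.restrict (Set.Icc (0 : ℝ) 1)).real
        {x | ∀ d ∈ D, (D.card : ℝ) ^ (η - 1) < nint (x * d)} ≤ C * (D.card : ℝ) ^ (-(η / 4)) := by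
  obtain ⟨s, hs⟩ := exists_pow_lt_of_lt_one (show 0 < η / 8 by positivity)
    (show (1 / 2 : ℝ) < 1 by norm_num)
  obtain ⟨C, hC, hE⟩ := exists_dilateEnergy_le s (η / 8) (by positivity)
  set r := ⌈1 / η⌉₊
  have hr : 0 < r := Nat.ceil_pos.mpr (by positivity)
  have hrη : 1 ≤ η * r := by
    have : 1 / η ≤ r := Nat.le_ceil _
    rwa [div_le_iff₀ hη, mul_comm] at this
  refine ⟨8 * C * (2 * r) ^ (2 : ℝ), by positivity, fun D hD hne => ?_⟩
  set H : ℝ := (D.card : ℝ)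
  have hH : 1 ≤ H := Nat.one_le_cast.mpr hne.card_pos
  have hH0 : 0 < H := by linarith
  set K := ⌈H ^ (1 - η / 2)⌉₊
  have hK : 0 < K := Nat.ceil_pos.mpr (by positivity)
  have hK1 : H ^ (1 - η / 2) ≤ K := Nat.le_ceil _
  have hone : 1 ≤ H ^ (1 - η / 2) := Real.one_le_rpow hH (by linarith)
  have hK2 : (K : ℝ) ≤ 2 * H ^ (1 - η / 2) := by
    have := Nat.ceil_lt_add_one (show 0 ≤ H ^ (1 - η / 2) by positivity)
    linarith
  have hK3 : H ^ (1 - η / 2) ≤ H := by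
    calc _ ≤ H ^ (1 : ℝ) := Real.rpow_le_rpow_of_exponent_le hH (by linarith)
      _ = H := Real.rpow_one H
  have hcond : (2 * (r * K : ℕ) : ℝ) ≤ (2 * K * H ^ (η - 1)) ^ (2 * r) := by
    have h1 : 2 * H ^ (η / 2) ≤ 2 * K * H ^ (η - 1) := by
      calc 2 * H ^ (η / 2) = 2 * H ^ (1 - η / 2) * H ^ (η - 1) := by
            rw [mul_assoc, ← Real.rpow_add hH0]; congr 2; ring
        _ ≤ _ := by gcongr
    have h2 : (2 * H ^ (η / 2)) ^ (2 * r) = 4 ^ r * H ^ (η * r) := by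
      rw [mul_pow, pow_mul, ← Real.rpow_natCast (H ^ (η / 2)), ← Real.rpow_mul hH0.le]
      congr 2
      · norm_num
      · push_cast; ring
    have h3 : H ≤ H ^ (η * r) := by
      calc H = H ^ (1 : ℝ) := (Real.rpow_one H).symm
        _ ≤ _ := Real.rpow_le_rpow_of_exponent_le hH hrη
    have h4 : (4 * r : ℝ) ≤ 4 ^ r := by
      obtain ⟨t, ht⟩ : ∃ t, r = t + 1 := ⟨r - 1, by omega⟩
      have : t < 4 ^ t := Nat.lt_pow_self (by norm_num)
      have : 4 * r ≤ 4 ^ r := by rw [ht, pow_succ]; omega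
      exact_mod_cast this
    calc (2 * (r * K : ℕ) : ℝ) = 2 * r * K := by push_cast; ring
      _ ≤ 2 * r * (2 * H) := by gcongr; linarith
      _ = 4 * r * H := by ring
      _ ≤ 4 ^ r * H ^ (η * r) := by gcongr
      _ = (2 * H ^ (η / 2)) ^ (2 * r) := h2.symm
      _ ≤ _ := by gcongr
  refine (volume_real_forall_lt_nint_le hD hne (by positivity) hK hr hcond).trans ?_
  have hMpos : 0 < r * K := Nat.mul_pos hr hK
  have hE' := hE (Fin (r * K - 1)) (fun i => (i : ℕ) + 1) (fun i => Nat.succ_pos _) (r * K) hMpos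
    (fun i => by have := i.2; omega) 1 (fun n => by
      have : (Finset.univ.filter fun i : Fin (r * K - 1) => (i : ℕ) + 1 = n).card ≤ 1 :=
        Finset.card_le_one.mpr fun i hi j hj => by
          simp only [Finset.mem_filter, Finset.mem_univ, true_and] at hi hj
          ext; omega
      exact_mod_cast this) D hD
  have hM : ((r * K : ℕ) : ℝ) ≤ 2 * r * H ^ (1 - η / 2) := by
    push_cast
    calc (r : ℝ) * K ≤ r * (2 * H ^ (1 - η / 2)) := by gcongr
      _ = _ := by ring
  have hr1 : (1 : ℝ) ≤ 2 * r := by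
    have : (1 : ℝ) ≤ r := by exact_mod_cast hr
    linarith
  have hMpow : ((r * K - 1 : ℕ) : ℝ) * ((r * K : ℕ) : ℝ) ^ (η / 8)
      ≤ (2 * r) ^ (2 : ℝ) * H ^ (1 - η / 2 + η / 8) := by
    calc _ ≤ ((r * K : ℕ) : ℝ) * ((r * K : ℕ) : ℝ) ^ (η / 8) := by
          gcongr
          exact Nat.sub_le _ _
      _ = ((r * K : ℕ) : ℝ) ^ (1 + η / 8) := by
          rw [Real.rpow_add (by exact_mod_cast hMpos), Real.rpow_one]
      _ ≤ (2 * r * H ^ (1 - η / 2)) ^ (1 + η / 8) := by gcongr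
      _ = (2 * r) ^ (1 + η / 8) * H ^ ((1 - η / 2) * (1 + η / 8)) := by
          rw [Real.mul_rpow (by positivity) (by positivity), ← Real.rpow_mul hH0.le]
      _ ≤ _ := by
          gcongr
          · linarith
          · nlinarith
  rw [div_le_iff₀ (by positivity)]
  calc 8 * (dilateEnergy (fun i : Fin (r * K - 1) => (i : ℕ) + 1) D : ℝ)
      ≤ 8 * (C * H ^ (1 + (1 / 2 : ℝ) ^ s) * ((r * K - 1 : ℕ) : ℝ) * 1 *
          ((r * K : ℕ) : ℝ) ^ (η / 8)) := by
        rw [Fintype.card_fin] at hE'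
        gcongr
    _ = 8 * C * (H ^ (1 + (1 / 2 : ℝ) ^ s) * (((r * K - 1 : ℕ) : ℝ) *
          ((r * K : ℕ) : ℝ) ^ (η / 8))) := by ring
    _ ≤ 8 * C * (H ^ (1 + η / 8) * ((2 * r) ^ (2 : ℝ) * H ^ (1 - η / 2 + η / 8))) := by
        gcongr
    _ = 8 * C * (2 * r) ^ (2 : ℝ) * (H ^ (1 + η / 8) * H ^ (1 - η / 2 + η / 8)) := by ring
    _ = 8 * C * (2 * r) ^ (2 : ℝ) * (H ^ (-(η / 4)) * H ^ (2 : ℝ)) := by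
        rw [← Real.rpow_add hH0, ← Real.rpow_add hH0]
        congr 2
        ring
    _ = _ := by simp only [Real.rpow_two, H]; ring

/-- The natural-number floors of the distances between the first `N` terms of `a`. -/
noncomputable def floorDiffs (a : ℕ → ℝ) (N : ℕ) : Finset ℕ :=
  (Finset.Icc 1 N).offDiag.image fun q => ⌊|a q.1 - a q.2|⌋₊

theorem mem_floorDiffs {a : ℕ → ℝ} {N d : ℕ} :
    d ∈ floorDiffs a N ↔ ∃ m n : ℕ, 1 ≤ m ∧ m ≤ N ∧ 1 ≤ n ∧ n ≤ N ∧ m ≠ n ∧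
      d = ⌊|a m - a n|⌋₊ := by
  simp only [floorDiffs, Finset.mem_image, Finset.mem_offDiag, Finset.mem_Icc, Prod.exists]
  constructor
  · rintro ⟨m, n, ⟨⟨h1, h2⟩, ⟨h3, h4⟩, h5⟩, rfl⟩
    exact ⟨m, n, h1, h2, h3, h4, h5, rfl⟩
  · rintro ⟨m, n, h1, h2, h3, h4, h5, rfl⟩
    exact ⟨m, n, ⟨⟨h1, h2⟩, ⟨h3, h4⟩, h5⟩, rfl⟩

theorem floorDiffs_mono (a : ℕ → ℝ) : Monotone (floorDiffs a) := fun N N' h d hd => by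
  obtain ⟨m, n, h1, h2, h3, h4, h5, h6⟩ := mem_floorDiffs.mp hd
  exact mem_floorDiffs.mpr ⟨m, n, h1, h2.trans h, h3, h4.trans h, h5, h6⟩

theorem Hcard_eq_card_floorDiffs (a : ℕ → ℝ) (N : ℕ) : Hcard a N = (floorDiffs a N).card := by
  rw [Hcard, ← Set.ncard_coe_finset,
    ← Set.ncard_image_of_injective (floorDiffs a N : Set ℕ) (Nat.cast_injective (R := ℤ))]
  congr 1
  ext k
  simp only [Set.mem_ofPred_eq, Set.mem_image, Finset.mem_coe, mem_floorDiffs]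
  constructor
  · rintro ⟨m, n, h1, h2, h3, h4, h5, rfl⟩
    exact ⟨_, ⟨m, n, h1, h2, h3, h4, h5, rfl⟩, Int.natCast_floor_eq_floor (abs_nonneg _)⟩
  · rintro ⟨_, ⟨m, n, h1, h2, h3, h4, h5, rfl⟩, rfl⟩
    exact ⟨m, n, h1, h2, h3, h4, h5, Int.natCast_floor_eq_floor (abs_nonneg _)⟩

theorem floorDeltaMin_le {a : ℕ → ℝ} {N d : ℕ} (hd : d ∈ floorDiffs a N) (α : ℝ) :
    floorDeltaMin a α N ≤ nint (α * d) := by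
  obtain ⟨m, n, h1, h2, h3, h4, h5, rfl⟩ := mem_floorDiffs.mp hd
  refine csInf_le ⟨0, ?_⟩ ⟨m, n, h1, h2, h3, h4, h5, ?_⟩
  · rintro _ ⟨_, _, _, _, _, _, _, rfl⟩
    exact abs_nonneg _
  · rw [natCast_floor_eq_intCast_floor (abs_nonneg _)]

theorem card_floorDiffs_le_sq (a : ℕ → ℝ) (N : ℕ) : (floorDiffs a N).card ≤ N ^ 2 := by
  refine Finset.card_image_le.trans ?_
  rw [Finset.offDiag_card, Nat.card_Icc, Nat.add_sub_cancel, sq]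
  exact Nat.sub_le _ _

theorem le_two_mul_card_floorDiffs_add_one {a : ℕ → ℝ}
    (hsep : ∀ m n, 1 ≤ m → 1 ≤ n → m ≠ n → 1 ≤ |a m - a n|) (N : ℕ) :
    N ≤ 2 * (floorDiffs a N).card + 1 := by
  classical
  have h : (Finset.Icc 2 N).card ≤ (floorDiffs a N ×ˢ (Finset.univ : Finset Bool)).card := by
    refine Finset.card_le_card_of_injOn
      (fun m => (⌊|a m - a 1|⌋₊, decide (a 1 ≤ a m))) (fun m hm => ?_) fun m hm n hn heq => ?_
    · have hm := Finset.mem_Icc.mp hm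
      simp only [Finset.coe_product, Set.mem_prod, Finset.mem_coe, Finset.mem_univ, and_true]
      exact mem_floorDiffs.mpr ⟨m, 1, by omega, hm.2, le_rfl, by omega, by omega, rfl⟩
    · have hm := Finset.mem_Icc.mp hm
      have hn := Finset.mem_Icc.mp hn
      simp only [Prod.mk.injEq, decide_eq_decide] at heq
      obtain ⟨h1, h2⟩ := heq
      by_contra hmn
      have h3 := hsep m n (by omega) (by omega) hmn
      have e1 := Nat.floor_le (abs_nonneg (a m - a 1))
      have e2 := Nat.lt_floor_add_one |a m - a 1|
      have e3 := Nat.floor_le (abs_nonneg (a n - a 1))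
      have e4 := Nat.lt_floor_add_one |a n - a 1|
      rw [h1] at e1 e2
      generalize ⌊|a n - a 1|⌋₊ = F at e1 e2 e3 e4
      refine absurd h3 (not_le.mpr ?_)
      by_cases h : a 1 ≤ a m
      · rw [abs_of_nonneg (sub_nonneg.mpr h)] at e1 e2
        rw [abs_of_nonneg (sub_nonneg.mpr (h2.mp h))] at e3 e4
        rw [abs_lt]
        constructor <;> linarith
      · have h' : ¬ a 1 ≤ a n := fun hh => h (h2.mpr hh)
        rw [abs_of_neg (sub_neg.mpr (not_le.mp h))] at e1 e2
        rw [abs_of_neg (sub_neg.mpr (not_le.mp h'))] at e3 e4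
        rw [abs_lt]
        constructor <;> linarith
  rw [Finset.card_product, Nat.card_Icc, Finset.card_univ, Fintype.card_bool] at h
  omega

theorem stmt6 (a : ℕ → ℝ)
    (hpos : ∀ n, 1 ≤ n → 0 < a n)
    (hdist : ∀ m n, 1 ≤ m → 1 ≤ n → m ≠ n → a m ≠ a n)
    (hsep : ∀ m n, 1 ≤ m → 1 ≤ n → m ≠ n → 1 ≤ |a m - a n|)
    (ε : ℝ) (hε : 0 < ε) :
    ∀ᵐ α ∂(volume.restrict (Set.Icc (0:ℝ) 1)),
      ∀ᶠ N in atTop, floorDeltaMin a α N ≤ (N : ℝ) ^ ε / (Hcard a N : ℝ) := by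
  set η := min (ε / 4) (1 / 2)
  have hη : 0 < η := lt_min (by positivity) (by norm_num)
  have hη1 : η < 1 := (min_le_right _ _).trans_lt (by norm_num)
  have hηε : η ≤ ε / 4 := min_le_left _ _
  have hDpos : ∀ N, ∀ d ∈ floorDiffs a N, 0 < d := fun N d hd => by
    obtain ⟨m, n, h1, h2, h3, h4, h5, rfl⟩ := mem_floorDiffs.mp hd
    exact Nat.floor_pos.mpr (hsep m n h1 h3 h5)
  have hgrow : ∀ k : ℕ, ∃ N, 2 ^ k ≤ (floorDiffs a N).card := fun k =>
    ⟨2 * 2 ^ k + 1, by have := le_two_mul_card_floorDiffs_add_one hsep (2 * 2 ^ k + 1); omega⟩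
  classical
  set N₀ : ℕ → ℕ := fun k => Nat.find (hgrow k)
  have hN₀ : ∀ k, 2 ^ k ≤ (floorDiffs a (N₀ k)).card := fun k => Nat.find_spec (hgrow k)
  obtain ⟨C, hC, hmeas⟩ := exists_volume_real_forall_lt_nint_le hη hη1
  set B : ℕ → Set ℝ := fun k => {x | ∀ d ∈ floorDiffs a (N₀ k),
    ((floorDiffs a (N₀ k)).card : ℝ) ^ (η - 1) < nint (x * d)}
  have hB : ∀ k, (volume.restrict (Set.Icc (0 : ℝ) 1)) (B k)
      ≤ ENNReal.ofReal (C * ((2 : ℝ) ^ (-(η / 4))) ^ k) := fun k => by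
    rw [← ofReal_measureReal]
    refine ENNReal.ofReal_le_ofReal ((hmeas _ (hDpos _)
      (Finset.card_pos.mp ((by positivity : 0 < 2 ^ k).trans_le (hN₀ k)))).trans ?_)
    gcongr
    rw [← Real.rpow_mul_natCast (by norm_num), mul_comm, Real.rpow_natCast_mul (by norm_num)]
    refine Real.rpow_le_rpow_of_nonpos (by positivity) ?_ (by linarith)
    exact_mod_cast hN₀ k
  have hsum : ∑' k, (volume.restrict (Set.Icc (0 : ℝ) 1)) (B k) ≠ ⊤ := by
    have hs : Summable fun k : ℕ => C * ((2 : ℝ) ^ (-(η / 4))) ^ k :=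
      (summable_geometric_of_lt_one (by positivity)
        (Real.rpow_lt_one_of_one_lt_of_neg (by norm_num) (by linarith))).mul_left C
    exact ne_top_of_le_ne_top hs.tsum_ofReal_ne_top (ENNReal.tsum_le_tsum hB)
  filter_upwards [ae_eventually_notMem hsum] with α hα
  obtain ⟨k₀, hk₀⟩ := eventually_atTop.mp hα
  have hlarge : ∀ᶠ N : ℕ in atTop, (2 : ℝ) ≤ (N : ℝ) ^ (ε / 2) :=
    ((tendsto_rpow_atTop (by positivity : 0 < ε / 2)).comp
      tendsto_natCast_atTop_atTop).eventually_ge_atTop 2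
  filter_upwards [hlarge, eventually_ge_atTop (N₀ k₀), eventually_ge_atTop 1] with N h2N hN hN1
  rw [Hcard_eq_card_floorDiffs]
  have hcard : 2 ^ k₀ ≤ (floorDiffs a N).card :=
    (hN₀ k₀).trans (Finset.card_le_card (floorDiffs_mono a hN))
  have hcard0 : (floorDiffs a N).card ≠ 0 := ((by positivity : 0 < 2 ^ k₀).trans_le hcard).ne'
  set k := Nat.log 2 (floorDiffs a N).card
  have hk : k₀ ≤ k := Nat.le_log_of_pow_le (by norm_num) hcard
  have hk1 : 2 ^ k ≤ (floorDiffs a N).card := Nat.pow_log_le_self 2 hcard0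
  have hk2 : (floorDiffs a N).card < 2 ^ (k + 1) := Nat.lt_pow_succ_log_self (by norm_num) _
  have hNk : N₀ k ≤ N := Nat.find_min' (hgrow k) hk1
  have hnot := hk₀ k hk
  simp only [B, Set.mem_ofPred_eq, not_forall, not_lt] at hnot
  obtain ⟨d, hd, hle⟩ := hnot
  set H : ℝ := ((floorDiffs a N).card : ℝ)
  have hH : 0 < H := Nat.cast_pos.mpr (Nat.pos_of_ne_zero hcard0)
  have hhalf : H / 2 ≤ ((floorDiffs a (N₀ k)).card : ℝ) := by
    have h1 : (floorDiffs a N).card ≤ 2 * (floorDiffs a (N₀ k)).card := by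
      have := hN₀ k
      rw [pow_succ] at hk2
      omega
    have h2 : ((floorDiffs a N).card : ℝ) ≤ 2 * ((floorDiffs a (N₀ k)).card : ℝ) := by
      exact_mod_cast h1
    linarith
  have hHN : ((floorDiffs a N).card : ℝ) ≤ (N : ℝ) ^ (2 : ℝ) := by
    rw [Real.rpow_two]
    exact_mod_cast card_floorDiffs_le_sq a N
  have hNR : (1 : ℝ) ≤ N := by exact_mod_cast hN1
  calc floorDeltaMin a α N ≤ nint (α * d) := floorDeltaMin_le (floorDiffs_mono a hNk hd) α
    _ ≤ ((floorDiffs a (N₀ k)).card : ℝ) ^ (η - 1) := hle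
    _ ≤ (H / 2) ^ (η - 1) := Real.rpow_le_rpow_of_nonpos (by positivity) hhalf (by linarith)
    _ = (H / 2) ^ η / (H / 2) := by rw [Real.rpow_sub_one (by positivity)]
    _ ≤ H ^ η / (H / 2) := by gcongr; linarith
    _ = 2 * H ^ η / H := by field_simp
    _ ≤ N ^ ε / H := by
        gcongr
        calc 2 * H ^ η ≤ (N : ℝ) ^ (ε / 2) * ((N : ℝ) ^ (2 : ℝ)) ^ η := by gcongr
          _ = (N : ℝ) ^ (ε / 2 + 2 * η) := by
              rw [← Real.rpow_mul (by positivity), ← Real.rpow_add (by positivity)]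
          _ ≤ (N : ℝ) ^ ε := Real.rpow_le_rpow_of_exponent_le hNR (by linarith)
end

section
/- Let (a_n)_{n≥1} be a sequence of non-negative real numbers, let ε > 0, and let A be an infinite subset of ℕ such that for each k ∈ A, ∑_{d | k, d ≥ log k} a_d ≥ ε, where the sum runs over the divisors d of k satisfying d ≥ log k. Then ∑_{k=1}^∞ a_k = ∞. -/
open scoped Classical

theorem stmt17 (a : ℕ → ℝ) (ha : ∀ n, 0 ≤ a n) (ε : ℝ) (hε : 0 < ε)
    (A : Set ℕ) (hA : A.Infinite)
    (hsum : ∀ k ∈ A,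
      ε ≤ ∑ d ∈ k.divisors.filter (fun d : ℕ => Real.log k ≤ (d : ℝ)), a d) :
    ¬ Summable a := by
  intro hs
  obtain ⟨s, hs⟩ := summable_iff_vanishing_norm.1 hs ε hε
  obtain ⟨k, hkA, hk⟩ := hA.exists_gt ⌈Real.exp (s.sup id : ℕ)⌉₊
  have hexp : Real.exp (s.sup id : ℕ) < k := Nat.lt_of_ceil_lt hk
  have hlog : ((s.sup id : ℕ) : ℝ) < Real.log k :=
    (Real.lt_log_iff_exp_lt ((Real.exp_pos _).trans hexp)).2 hexp
  refine ((hsum k hkA).trans (le_abs_self _)).not_gt (hs _ ?_)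
  refine Finset.disjoint_left.2 fun d hd hds => ?_
  have hle : (d : ℝ) ≤ (s.sup id : ℕ) := by exact_mod_cast Finset.le_sup (f := id) hds
  exact (hle.trans_lt hlog).not_ge (Finset.mem_filter.1 hd).2
end

section
/- Let (a_n)_{n≥1} be a sequence of positive real numbers such that inf_{1≤m≠n≤N} |a_m − a_n| ≥ 1 for all N, and let (η(N))_{N≥1} be a sequence of non-negative reals with limsup_{k→∞} η(k) > 0. Then for almost all α ∈ [0,1], the inequality ⌊δ_min^α⌋(N) ≤ η(N) holds for infinitely many N. -/
open MeasureTheory Filter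

open Set Metric Topology Pointwise in
/-- A closed ball of radius `1 / (2 n)` is a fundamental domain for the rotation by `1 / n`, so the
preimage of a set under multiplication by `n` occupies the same proportion of every such ball. -/
theorem UnitAddCircle.volume_preimage_nsmul_inter_closedBall_div {n : ℕ} (hn : 0 < n)
    {s : Set UnitAddCircle} (hs : MeasurableSet s) (d : UnitAddCircle) :
    volume (((fun x : UnitAddCircle => n • x) ⁻¹' s) ∩ closedBall d (1 / (2 * n))) /
      volume (closedBall d (1 / (2 * (n : ℝ)))) = volume s := by
  set t : Set UnitAddCircle := (fun x : UnitAddCircle => n • x) ⁻¹' s with ht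
  let u : UnitAddCircle := ((1 / (n : ℝ) : ℝ) : UnitAddCircle)
  have hu : addOrderOf u = n := AddCircle.addOrderOf_period_div hn
  have hnu : n • u = 0 := by
    conv_lhs => rw [← hu]
    exact addOrderOf_nsmul_eq_zero u
  have htu : u +ᵥ t = t := by
    ext x
    rw [mem_vadd_set_iff_neg_vadd_mem]
    simp [ht, smul_add, hnu]
  have hvol : volume t = n • volume (t ∩ closedBall d (1 / (2 * n))) := by
    have h := AddCircle.volume_of_add_preimage_eq (T := 1) t (closedBall d (1 / (2 * n))) u d
      (addOrderOf_pos_iff.mp (hu ▸ hn)) (.of_eq htu)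
      (by rw [hu]; exact AddCircle.closedBall_ae_eq_ball)
    rwa [hu] at h
  have hts : volume t = volume s := by
    have hmp : MeasurePreserving (fun x : UnitAddCircle => (n : ℤ) • x) volume volume :=
      Measure.measurePreserving_zsmul volume (by exact_mod_cast hn.ne')
    simp only [natCast_zsmul] at hmp
    exact hmp.measure_preimage hs.nullMeasurableSet
  have hball : volume (closedBall d (1 / (2 * (n : ℝ)))) = (n : ENNReal)⁻¹ := by
    have hn1 : (1 : ℝ) ≤ n := by exact_mod_cast hn
    have h2 : 2 * (1 / (2 * (n : ℝ))) = (n : ℝ)⁻¹ := by field_simp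
    rw [AddCircle.volume_closedBall, h2, min_eq_right (inv_le_one_of_one_le₀ hn1),
      ENNReal.ofReal_inv_of_pos (by positivity), ENNReal.ofReal_natCast]
  rw [hball, div_eq_mul_inv, inv_inv, mul_comm, ← nsmul_eq_mul, ← hvol, hts]

open Set Metric Topology in
/-- Almost every point of the circle has a multiple close to `0` along any prescribed sequence of
multipliers tending to infinity. -/
theorem UnitAddCircle.ae_exists_norm_nsmul_le {k : ℕ → ℕ} (hk : Tendsto k atTop atTop)
    {u : ℝ} (hu : 0 < u) : ∀ᵐ x : UnitAddCircle, ∃ j, ‖k j • x‖ ≤ u := by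
  let E : Set UnitAddCircle := {x | ¬ ∃ j, ‖k j • x‖ ≤ u}
  change volume E = 0
  by_contra h
  obtain ⟨d, -, hd⟩ : ∃ d, d ∈ E ∧ ∀ {ι : Type} {l : Filter ι} (w : ι → UnitAddCircle) (δ : ι → ℝ),
      Tendsto δ l (𝓝[>] 0) → (∀ᶠ j in l, d ∈ closedBall (w j) (1 * δ j)) →
      Tendsto (fun j => volume (E ∩ closedBall (w j) (δ j)) / volume (closedBall (w j) (δ j))) l
        (𝓝 1) :=
    Measure.exists_mem_of_measure_ne_zero_of_ae h
      (IsUnifLocDoublingMeasure.ae_tendsto_measure_inter_div volume E 1)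
  have hpos : ∀ᶠ j in atTop, 0 < k j := hk.eventually_gt_atTop 0
  have hδ : Tendsto (fun j => 1 / (2 * (k j : ℝ))) atTop (𝓝[>] 0) := by
    refine tendsto_nhdsWithin_iff.mpr ⟨?_, hpos.mono fun j hj => ?_⟩
    · simp only [one_div]
      exact ((tendsto_natCast_atTop_iff.mpr hk).const_mul_atTop two_pos).inv_tendsto_atTop
    · have : (0 : ℝ) < k j := by exact_mod_cast hj
      exact mem_Ioi.mpr (by positivity)
  have hlim := hd (fun _ => d) (fun j => 1 / (2 * (k j : ℝ))) hδ
    (.of_forall fun j => by simp only [one_mul]; exact mem_closedBall_self (by positivity))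
  have hle : (1 : ENNReal) ≤ volume (closedBall (0 : UnitAddCircle) u)ᶜ := by
    refine le_of_tendsto hlim (hpos.mono fun j hj => ?_)
    rw [← volume_preimage_nsmul_inter_closedBall_div hj
      isClosed_closedBall.measurableSet.compl d]
    gcongr
    intro x hx hx'
    exact hx ⟨j, by simpa using hx'⟩
  rw [measure_compl isClosed_closedBall.measurableSet (measure_ne_top _ _),
    UnitAddCircle.measure_univ] at hle
  exact (ENNReal.sub_lt_self ENNReal.one_ne_top one_ne_zero
    (measure_closedBall_pos volume _ hu).ne').not_ge hle

theorem nint_mul_natCast (α : ℝ) (n : ℕ) : nint (α * n) = ‖n • (α : UnitAddCircle)‖ := by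
  rw [← AddCircle.coe_nsmul, UnitAddCircle.norm_eq, nsmul_eq_mul, mul_comm, nint]

/-- A sequence of positive reals with gaps at least one is unbounded. -/
theorem exists_le_of_one_le_abs_sub {a : ℕ → ℝ} (hpos : ∀ n, 1 ≤ n → 0 < a n)
    (hsep : ∀ m n, 1 ≤ m → 1 ≤ n → m ≠ n → 1 ≤ |a m - a n|) (M : ℝ) :
    ∃ n, 1 ≤ n ∧ M ≤ a n := by
  by_contra! h
  have hmaps : ∀ n : ℕ, ⌊a (n + 1)⌋ ∈ Set.Icc (0 : ℤ) ⌊M⌋ := fun n =>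
    ⟨Int.floor_nonneg.mpr (hpos _ (by omega)).le, Int.floor_mono (h _ (by omega)).le⟩
  have hinj : Function.Injective fun n : ℕ => ⌊a (n + 1)⌋ := fun m n hmn => by
    by_contra hne
    exact (Int.abs_sub_lt_one_of_floor_eq_floor hmn).not_ge
      (hsep _ _ (by omega) (by omega) (by omega))
  exact Set.infinite_of_injective_forall_mem hinj hmaps (Set.finite_Icc _ _)

theorem floorDeltaMin_le_s19 {a : ℕ → ℝ} {α : ℝ} {N m n : ℕ} (hm : 1 ≤ m) (hmN : m ≤ N)
    (hn : 1 ≤ n) (hnN : n ≤ N) (hmn : m ≠ n) :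
    floorDeltaMin a α N ≤ nint (α * (⌊|a m - a n|⌋ : ℝ)) := by
  refine csInf_le ⟨0, ?_⟩ ⟨m, n, hm, hmN, hn, hnN, hmn, rfl⟩
  rintro _ ⟨m, n, -, -, -, -, -, rfl⟩
  exact abs_nonneg _

theorem stmt19 (a : ℕ → ℝ)
    (hpos : ∀ n, 1 ≤ n → 0 < a n)
    (hsep : ∀ m n, 1 ≤ m → 1 ≤ n → m ≠ n → 1 ≤ |a m - a n|)
    (η : ℕ → ℝ) (hη : ∀ N, 0 ≤ η N)
    (hlimsup : ∃ u : ℝ, 0 < u ∧ ∃ᶠ k in atTop, u ≤ η k) :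
    ∀ᵐ α ∂(volume.restrict (Set.Icc (0:ℝ) 1)),
      ∃ᶠ N in atTop, floorDeltaMin a α N ≤ η N := by
  obtain ⟨u, hu, hfreq⟩ := hlimsup
  choose f hf1 hf using fun j : ℕ => exists_le_of_one_le_abs_sub hpos hsep (a 1 + (j + 1))
  have hne : ∀ j, 1 ≠ f j := fun j h => by
    have := hf j
    rw [← h] at this
    have hj : (0 : ℝ) ≤ j := j.cast_nonneg
    linarith
  have hk : Tendsto (fun j => ⌊|a 1 - a (f j)|⌋₊) atTop atTop := by
    refine tendsto_atTop_mono (fun j => Nat.le_floor ?_) tendsto_id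
    have := neg_le_abs (a 1 - a (f j))
    have := hf j
    simp only [id]
    linarith
  have hae := (UnitAddCircle.measurePreserving_mk 0).quasiMeasurePreserving.ae
    (UnitAddCircle.ae_exists_norm_nsmul_le hk hu)
  rw [zero_add, Measure.restrict_congr_set Ioc_ae_eq_Icc] at hae
  filter_upwards [hae] with α ⟨j, hj⟩
  refine (hfreq.and_eventually (eventually_ge_atTop (f j))).mono fun N ⟨hN, hfN⟩ => ?_
  refine (floorDeltaMin_le_s19 le_rfl ((hf1 j).trans hfN) (hf1 j) hfN (hne j)).trans (le_trans ?_ hN)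
  rw [← nint_mul_natCast, natCast_floor_eq_intCast_floor (abs_nonneg _)] at hj
  exact hj
end
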